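/- Let I be the icosahedron graph: the simple graph on vertex set {0,1,...,11} whose edges are: vertex 0 adjacent to 1,2,3,4,5; the 5-cycle 1–2–3–4–5–1; vertex 11 adjacent to 6,7,8,9,10; the 5-cycle 6–7–8–9–10–6; and the edges 1–6, 1–7, 2–7, 2–8, 3–8, 3–9, 4–9, 4–10, 5–10, 5–6. Then I is 5-list-edge-colorable. -/

import Mathlib

/-- `G` is `k`-list-edge-colorable: for every assignment of a finite list of at
least `k` colors to each edge there is a proper edge coloring choosing each
edge's color from its list. -/
def ListEdgeColorable {V : Type} (G : SimpleGraph V) (k : ℕ) : Prop :=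
  ∀ (α : Type) (L : Sym2 V → Finset α), (∀ e ∈ G.edgeSet, k ≤ (L e).card) →
    ∃ c : Sym2 V → α, (∀ e ∈ G.edgeSet, c e ∈ L e) ∧
      ∀ e₁ ∈ G.edgeSet, ∀ e₂ ∈ G.edgeSet, e₁ ≠ e₂ → (∃ v, v ∈ e₁ ∧ v ∈ e₂) →
        c e₁ ≠ c e₂

/-- The icosahedron graph. -/
def icosahedron : SimpleGraph (Fin 12) :=
  SimpleGraph.fromEdgeSet
    {s(0, 1), s(0, 2), s(0, 3), s(0, 4), s(0, 5), s(1, 2), s(1, 5), s(1, 6), s(1, 7), s(2, 3), s(2, 7), s(2, 8), s(3, 4), s(3, 8), s(3, 9), s(4, 5), s(4, 9), s(4, 10), s(5, 6), s(5, 10), s(6, 7), s(6, 10), s(6, 11), s(7, 8), s(7, 11), s(8, 9), s(8, 11), s(9, 10), s(9, 11), s(10, 11)}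

open Finset

section Interpolation

variable {R E ι : Type*} [CommRing R] [Fintype E] [Fintype ι]

/-- If the weights `w` at the nodes `a` annihilate all powers below `d`, then the product
weights on the grid extract the coefficient of `∏ e, X e ^ d` from any polynomial whose total
degree is at most that of this monomial. -/
theorem MvPolynomial.sum_prod_weight_mul_eval [DecidableEq E] {w a : ι → R} {d : ℕ} {μ : R}
    (hlt : ∀ k < d, ∑ c, w c * a c ^ k = 0) (hd : ∑ c, w c * a c ^ d = μ)
    (p : MvPolynomial E R) (hp : p.totalDegree ≤ Fintype.card E * d) :
    ∑ s : E → ι, (∏ e, w (s e)) * p.eval (fun e => a (s e)) =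
      μ ^ Fintype.card E * p.coeff (Finsupp.equivFunOnFinite.symm fun _ => d) := by
  have hmono (m : E →₀ ℕ) : ∑ s : E → ι, (∏ e, w (s e)) * ∏ e, a (s e) ^ m e =
      ∏ e, ∑ c, w c * a c ^ m e := by
    rw [Finset.prod_univ_sum, Fintype.piFinset_univ]
    simp_rw [Finset.prod_mul_distrib]
  set t : E →₀ ℕ := Finsupp.equivFunOnFinite.symm fun _ => d with ht
  have hzero (m : E →₀ ℕ) (hm : m ∈ p.support) (hmt : m ≠ t) :
      ∏ e, ∑ c, w c * a c ^ m e = 0 := by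
    obtain ⟨e, he⟩ : ∃ e, m e < d := by
      by_contra! h
      have hsum : ∑ e, m e ≤ ∑ _e : E, d := by
        have := (MvPolynomial.le_totalDegree hm).trans hp
        rw [Finsupp.sum_fintype _ _ fun _ => rfl] at this
        simpa using this
      have heq := (Finset.sum_eq_sum_iff_of_le fun e _ => h e).1
        (le_antisymm (Finset.sum_le_sum fun e _ => h e) hsum)
      exact hmt (Finsupp.ext fun e => by simpa [ht] using (heq e (mem_univ e)).symm)
    exact Finset.prod_eq_zero (mem_univ e) (hlt _ he)
  calc ∑ s : E → ι, (∏ e, w (s e)) * p.eval (fun e => a (s e))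
      = ∑ m ∈ p.support, p.coeff m * ∏ e, ∑ c, w c * a c ^ m e := by
        simp_rw [MvPolynomial.eval_eq', Finset.mul_sum]
        rw [Finset.sum_comm]
        refine Finset.sum_congr rfl fun m _ => ?_
        rw [← hmono, Finset.mul_sum]
        exact Finset.sum_congr rfl fun s _ => by ring
    _ = p.coeff t * ∏ e, ∑ c, w c * a c ^ t e := by
        refine Finset.sum_eq_single t (fun m hm hmt => ?_) fun h => ?_
        · rw [hzero m hm hmt, mul_zero]
        · rw [MvPolynomial.notMem_support_iff.1 h, zero_mul]
    _ = _ := by simp [ht, hd, mul_comm]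

end Interpolation

section VandermondeProduct

variable {R V E : Type*} [CommRing R] [Fintype V]

/-- The product over all vertices `v` of the Vandermonde determinants in the values of `x` on
the five edges `inc v` at `v`. -/
noncomputable def vandermondeProduct (inc : V → Fin 5 → E) (x : E → R) : R :=
  ∏ v, (Matrix.vandermonde fun i => x (inc v i)).det

theorem map_vandermondeProduct {S : Type*} [CommRing S] (f : R →+* S) (inc : V → Fin 5 → E)
    (x : E → R) : f (vandermondeProduct inc x) = vandermondeProduct inc fun e => f (x e) := by
  simp [vandermondeProduct, Matrix.det_vandermonde, map_prod]

theorem vandermondeProduct_ne_zero_iff [IsDomain R] {inc : V → Fin 5 → E} {x : E → R} :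
    vandermondeProduct inc x ≠ 0 ↔ ∀ v, Function.Injective fun i => x (inc v i) := by
  simp [vandermondeProduct, Finset.prod_ne_zero_iff, Matrix.det_vandermonde_ne_zero_iff]

theorem totalDegree_vandermondeProduct_X (inc : V → Fin 5 → E) :
    (vandermondeProduct inc (MvPolynomial.X : E → MvPolynomial E ℤ)).totalDegree ≤
      Fintype.card V * 10 := by
  have hv (v : V) : (Matrix.vandermonde fun i =>
      (MvPolynomial.X (inc v i) : MvPolynomial E ℤ)).det.totalDegree ≤ 10 := by
    rw [Matrix.det_vandermonde]
    calc _ ≤ ∑ i : Fin 5, ∑ _j ∈ Finset.Ioi i, 1 := by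
          refine (MvPolynomial.totalDegree_finsetProd _ _).trans (sum_le_sum fun i _ => ?_)
          refine (MvPolynomial.totalDegree_finsetProd _ _).trans (sum_le_sum fun j _ => ?_)
          exact (MvPolynomial.totalDegree_sub _ _).trans (by simp)
      _ = 10 := by decide
  refine (MvPolynomial.totalDegree_finsetProd _ _).trans ((sum_le_sum fun v _ => hv v).trans ?_)
  simp

/-- Renaming the five colors of an edge coloring that is bijective at each vertex multiplies
every Vandermonde determinant by the sign of the renaming. -/
theorem vandermondeProduct_perm (inc : V → Fin 5 → E) (s : E → Fin 5)
    (hs : ∀ v, Function.Injective fun i => s (inc v i)) (τ : Equiv.Perm (Fin 5)) :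
    vandermondeProduct inc (fun e => ((τ (s e) : ℕ) : ℤ)) =
      (Equiv.Perm.sign τ : ℤ) ^ Fintype.card V *
        vandermondeProduct inc fun e => ((s e : ℕ) : ℤ) := by
  have key (π : Equiv.Perm (Fin 5)) :
      (Matrix.vandermonde fun i => ((π i : ℕ) : ℤ)).det =
        Equiv.Perm.sign π * (Matrix.vandermonde fun i : Fin 5 => ((i : ℕ) : ℤ)).det :=
    Matrix.det_permute π (Matrix.vandermonde fun i : Fin 5 => ((i : ℕ) : ℤ))
  have hv (v : V) : (Matrix.vandermonde fun i => ((τ (s (inc v i)) : ℕ) : ℤ)).det =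
      Equiv.Perm.sign τ * (Matrix.vandermonde fun i => ((s (inc v i) : ℕ) : ℤ)).det := by
    have h₁ := key (Equiv.ofBijective _ (Finite.injective_iff_bijective.1 (hs v)))
    have h₂ := key (τ * Equiv.ofBijective _ (Finite.injective_iff_bijective.1 (hs v)))
    simp only [Equiv.Perm.coe_mul, Function.comp_apply, Equiv.ofBijective_apply,
      Equiv.Perm.sign_mul, Units.val_mul] at h₁ h₂
    rw [h₁, h₂, mul_assoc]
  simp only [vandermondeProduct, hv, prod_mul_distrib, prod_const, card_univ]

end VandermondeProduct

section Search

/-- Checks `f c` for all colors `c < 5` not in the list `l`. -/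
def forallAvoiding (l : List ℕ) (f : ℕ → Bool) : Bool :=
  [0, 1, 2, 3, 4].all fun c => l.any (Nat.beq c) || f c

theorem apply_of_forallAvoiding {l : List ℕ} {f : ℕ → Bool} (h : forallAvoiding l f = true)
    {c : ℕ} (hc : c < 5) (hl : c ∉ l) : f c = true := by
  have hmem : c ∈ [0, 1, 2, 3, 4] := by simp; omega
  have hor := List.all_eq_true.1 h c hmem
  rw [Bool.or_eq_true, List.any_eq_true] at hor
  refine hor.resolve_left ?_
  rintro ⟨b, hb, hcb⟩
  exact hl (Nat.eq_of_beq_eq_true hcb ▸ hb)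

end Search

namespace Icosahedron

/-- The edges of the icosahedron in lexicographic order. -/
def edge : Fin 30 → Sym2 (Fin 12) :=
  ![s(0, 1), s(0, 2), s(0, 3), s(0, 4), s(0, 5), s(1, 2), s(1, 5), s(1, 6), s(1, 7), s(2, 3),
    s(2, 7), s(2, 8), s(3, 4), s(3, 8), s(3, 9), s(4, 5), s(4, 9), s(4, 10), s(5, 6), s(5, 10),
    s(6, 7), s(6, 10), s(6, 11), s(7, 8), s(7, 11), s(8, 9), s(8, 11), s(9, 10), s(9, 11),
    s(10, 11)]

/-- The five edges at each vertex, in increasing order. -/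
def incidence : Fin 12 → Fin 5 → Fin 30 :=
  ![![0, 1, 2, 3, 4], ![0, 5, 6, 7, 8], ![1, 5, 9, 10, 11], ![2, 9, 12, 13, 14],
    ![3, 12, 15, 16, 17], ![4, 6, 15, 18, 19], ![7, 18, 20, 21, 22], ![8, 10, 20, 23, 24],
    ![11, 13, 23, 25, 26], ![14, 16, 25, 27, 28], ![17, 19, 21, 27, 29], ![22, 24, 26, 28, 29]]

/-- The product of the differences of five integers. -/
def differences (a b c d e : ℤ) : ℤ :=
  (b - a) * (c - a) * (d - a) * (e - a) * (c - b) * (d - b) * (e - b) * (d - c) * (e - c) * (e - d)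

theorem det_vandermonde_eq_differences (x : Fin 5 → ℤ) :
    (Matrix.vandermonde x).det = differences (x 0) (x 1) (x 2) (x 3) (x 4) := by
  rw [Matrix.det_vandermonde]
  have h (i : Fin 5) : Finset.Ioi i = univ.filter (i < ·) := by ext; simp
  simp only [h, prod_filter, Fin.prod_univ_five, differences]
  simp only [Fin.isValue, Fin.reduceLT, lt_self_iff_false, reduceIte]
  ring

/-- Extends the colors of the edges at vertex `0` to all proper colorings with colors below `5`,
one edge at a time, and checks that each has positive Vandermonde product. -/
def forallExtensionsPositive (c0 c1 c2 c3 c4 : ℕ) : Bool :=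
  forallAvoiding [c0, c1] fun c5 =>
  forallAvoiding [c0, c4, c5] fun c6 =>
  forallAvoiding [c0, c5, c6] fun c7 =>
  forallAvoiding [c0, c5, c6, c7] fun c8 =>
  forallAvoiding [c1, c2, c5] fun c9 =>
  forallAvoiding [c1, c5, c8, c9] fun c10 =>
  forallAvoiding [c1, c5, c9, c10] fun c11 =>
  forallAvoiding [c2, c3, c9] fun c12 =>
  forallAvoiding [c2, c9, c11, c12] fun c13 =>
  forallAvoiding [c2, c9, c12, c13] fun c14 =>
  forallAvoiding [c3, c4, c6, c12] fun c15 =>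
  forallAvoiding [c3, c12, c14, c15] fun c16 =>
  forallAvoiding [c3, c12, c15, c16] fun c17 =>
  forallAvoiding [c4, c6, c7, c15] fun c18 =>
  forallAvoiding [c4, c6, c15, c17, c18] fun c19 =>
  forallAvoiding [c7, c8, c10, c18] fun c20 =>
  forallAvoiding [c7, c17, c18, c19, c20] fun c21 =>
  forallAvoiding [c7, c18, c20, c21] fun c22 =>
  forallAvoiding [c8, c10, c11, c13, c20] fun c23 =>
  forallAvoiding [c8, c10, c20, c22, c23] fun c24 =>
  forallAvoiding [c11, c13, c14, c16, c23] fun c25 =>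
  forallAvoiding [c11, c13, c22, c23, c24, c25] fun c26 =>
  forallAvoiding [c14, c16, c17, c19, c21, c25] fun c27 =>
  forallAvoiding [c14, c16, c22, c24, c25, c26, c27] fun c28 =>
  forallAvoiding [c17, c19, c21, c22, c24, c26, c27, c28] fun c29 =>
  decide (0 <
    differences c0 c1 c2 c3 c4 * differences c0 c5 c6 c7 c8 *
    differences c1 c5 c9 c10 c11 * differences c2 c9 c12 c13 c14 *
    differences c3 c12 c15 c16 c17 * differences c4 c6 c15 c18 c19 *
    differences c7 c18 c20 c21 c22 * differences c8 c10 c20 c23 c24 *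
    differences c11 c13 c23 c25 c26 * differences c14 c16 c25 c27 c28 *
    differences c17 c19 c21 c27 c29 * differences c22 c24 c26 c28 c29)

theorem forallExtensionsPositive_eq_true : forallExtensionsPositive 0 1 2 3 4 = true := by
  decide +kernel

/-- Vigneron's sign lemma for the icosahedron, for colorings normalized at vertex `0`. -/
theorem vandermondeProduct_pos_of_normalized (s : Fin 30 → Fin 5)
    (hs : ∀ v, Function.Injective fun i => s (incidence v i)) (h0 : ∀ i, s (incidence 0 i) = i) :
    0 < vandermondeProduct incidence fun e => ((s e : ℕ) : ℤ) := by
  have step {f : ℕ → Bool} (e : Fin 30) (l : List (Fin 30))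
      (h : forallAvoiding (l.map fun e' => (s e' : ℕ)) f = true)
      (hl : ∀ e' ∈ l, ∃ v i i', i ≠ i' ∧ incidence v i = e' ∧ incidence v i' = e) :
      f (s e) = true := by
    refine apply_of_forallAvoiding h (s e).2 fun hmem => ?_
    obtain ⟨e', he', heq⟩ := List.mem_map.1 hmem
    obtain ⟨v, i, i', hii', rfl, rfl⟩ := hl e' he'
    exact hii' (hs v (Fin.ext heq))
  have h : forallExtensionsPositive (s 0) (s 1) (s 2) (s 3) (s 4) = true := by
    rw [show s 0 = 0 from h0 0, show s 1 = 1 from h0 1, show s 2 = 2 from h0 2,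
      show s 3 = 3 from h0 3, show s 4 = 4 from h0 4]
    exact forallExtensionsPositive_eq_true
  unfold forallExtensionsPositive at h
  replace h := step 5 [0, 1] h (by decide)
  replace h := step 6 [0, 4, 5] h (by decide)
  replace h := step 7 [0, 5, 6] h (by decide)
  replace h := step 8 [0, 5, 6, 7] h (by decide)
  replace h := step 9 [1, 2, 5] h (by decide)
  replace h := step 10 [1, 5, 8, 9] h (by decide)
  replace h := step 11 [1, 5, 9, 10] h (by decide)
  replace h := step 12 [2, 3, 9] h (by decide)
  replace h := step 13 [2, 9, 11, 12] h (by decide)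
  replace h := step 14 [2, 9, 12, 13] h (by decide)
  replace h := step 15 [3, 4, 6, 12] h (by decide)
  replace h := step 16 [3, 12, 14, 15] h (by decide)
  replace h := step 17 [3, 12, 15, 16] h (by decide)
  replace h := step 18 [4, 6, 7, 15] h (by decide)
  replace h := step 19 [4, 6, 15, 17, 18] h (by decide)
  replace h := step 20 [7, 8, 10, 18] h (by decide)
  replace h := step 21 [7, 17, 18, 19, 20] h (by decide)
  replace h := step 22 [7, 18, 20, 21] h (by decide)
  replace h := step 23 [8, 10, 11, 13, 20] h (by decide)
  replace h := step 24 [8, 10, 20, 22, 23] h (by decide)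
  replace h := step 25 [11, 13, 14, 16, 23] h (by decide)
  replace h := step 26 [11, 13, 22, 23, 24, 25] h (by decide)
  replace h := step 27 [14, 16, 17, 19, 21, 25] h (by decide)
  replace h := step 28 [14, 16, 22, 24, 25, 26, 27] h (by decide)
  replace h := step 29 [17, 19, 21, 22, 24, 26, 27, 28] h (by decide)
  rw [decide_eq_true_eq] at h
  simp only [vandermondeProduct, det_vandermonde_eq_differences, Fin.prod_univ_castSucc,
    Fin.prod_univ_zero, one_mul]
  exact h

/-- Vigneron's sign lemma for the icosahedron: all proper `5`-edge-colorings have the same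
sign. -/
theorem vandermondeProduct_pos (s : Fin 30 → Fin 5)
    (hs : ∀ v, Function.Injective fun i => s (incidence v i)) :
    0 < vandermondeProduct incidence fun e => ((s e : ℕ) : ℤ) := by
  set π := Equiv.ofBijective _ (Finite.injective_iff_bijective.1 (hs 0)) with hπ
  have h := vandermondeProduct_pos_of_normalized (fun e => π⁻¹ (s e))
    (fun v => π⁻¹.injective.comp (hs v)) fun i => by
      rw [Equiv.Perm.inv_eq_iff_eq]
      rfl
  rw [vandermondeProduct_perm incidence s hs] at h
  have hsign : (Equiv.Perm.sign π⁻¹ : ℤ) ^ Fintype.card (Fin 12) = 1 := by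
    rcases Int.units_eq_one_or (Equiv.Perm.sign π⁻¹) with h | h <;> simp [h]
  rwa [hsign, one_mul] at h

/-- The fourth finite difference, as weights on `0, …, 4`. -/
def weight (c : Fin 5) : ℤ := (-1) ^ (c : ℕ) * Nat.choose 4 c

theorem prod_weight_pos (s : Fin 30 → Fin 5)
    (hs : ∀ v, Function.Injective fun i => s (incidence v i)) : 0 < ∏ e, weight (s e) := by
  have hsum : ∑ e, (s e : ℕ) = 60 := by
    have hdouble : ∑ v, ∑ i, (s (incidence v i) : ℕ) = 2 * ∑ e, (s e : ℕ) := by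
      have hcard : ∀ e, Fintype.card {p : Fin 12 × Fin 5 // incidence p.1 p.2 = e} = 2 := by
        decide +kernel
      rw [← Fintype.sum_prod_type' fun v i => (s (incidence v i) : ℕ),
        ← Fintype.sum_fiberwise' (fun p : Fin 12 × Fin 5 => incidence p.1 p.2)
          fun e => (s e : ℕ), mul_sum]
      simp only [sum_const, card_univ, hcard, smul_eq_mul]
    have hv (v : Fin 12) : ∑ i, (s (incidence v i) : ℕ) = 10 :=
      (Function.Bijective.sum_comp (Finite.injective_iff_bijective.1 (hs v))
        (fun c : Fin 5 => (c : ℕ))).trans (by decide)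
    simp only [hv] at hdouble
    simp at hdouble
    omega
  simp only [weight, prod_mul_distrib, prod_pow_eq_pow_sum, hsum]
  refine mul_pos (by norm_num) (prod_pos fun e _ => ?_)
  exact_mod_cast Nat.choose_pos (by omega)

theorem exists_proper_coloring :
    ∃ s : Fin 30 → Fin 5, ∀ v, Function.Injective fun i => s (incidence v i) :=
  ⟨![0, 1, 2, 3, 4, 2, 1, 3, 4, 0, 3, 4, 1, 3, 4, 0, 2, 4, 2, 3, 0, 1, 4, 2, 1, 1, 0, 0, 3, 2],
    by decide +kernel⟩

theorem coeff_vandermondeProduct_ne_zero :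
    (vandermondeProduct incidence (MvPolynomial.X : Fin 30 → MvPolynomial (Fin 30) ℤ)).coeff
      (Finsupp.equivFunOnFinite.symm fun _ => 4) ≠ 0 := by
  intro h0
  have h := MvPolynomial.sum_prod_weight_mul_eval (E := Fin 30) (w := weight)
    (a := fun c : Fin 5 => ((c : ℕ) : ℤ)) (d := 4) (μ := 24) (by decide +kernel)
    (by decide +kernel) _
    (totalDegree_vandermondeProduct_X incidence)
  simp only [h0, mul_zero, map_vandermondeProduct, MvPolynomial.eval_X] at h
  have hinj {s : Fin 30 → Fin 5}
      (hs : vandermondeProduct incidence (fun e => ((s e : ℕ) : ℤ)) ≠ 0) (v : Fin 12) :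
      Function.Injective fun i => s (incidence v i) := fun i j hij =>
    vandermondeProduct_ne_zero_iff.1 hs v (congrArg (fun c : Fin 5 => ((c : ℕ) : ℤ)) hij)
  have hnonneg (s : Fin 30 → Fin 5) : 0 ≤ (∏ e, weight (s e)) *
      vandermondeProduct incidence (fun e => ((s e : ℕ) : ℤ)) := by
    by_cases hs : vandermondeProduct incidence (fun e => ((s e : ℕ) : ℤ)) = 0
    · simp [hs]
    · exact (mul_pos (prod_weight_pos s (hinj hs))
        (vandermondeProduct_pos s (hinj hs))).le
  obtain ⟨s₀, hs₀⟩ := exists_proper_coloring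
  refine (sum_pos' (fun s _ => hnonneg s) ⟨s₀, mem_univ _, ?_⟩).ne' h
  exact mul_pos (prod_weight_pos s₀ hs₀) (vandermondeProduct_pos s₀ hs₀)

theorem exists_injective_choice {α : Type*} (L : Fin 30 → Finset α) (hL : ∀ e, 5 ≤ #(L e)) :
    ∃ x : Fin 30 → α, (∀ e, x e ∈ L e) ∧ ∀ v, Function.Injective fun i => x (incidence v i) := by
  classical
  obtain ⟨f, hf⟩ := Set.countable_iff_exists_injOn.1
    (univ.biUnion L).finite_toSet.countable
  have hmem {e : Fin 30} {c : α} (hc : c ∈ L e) : c ∈ (↑(univ.biUnion L) : Set α) := by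
    simpa using ⟨e, hc⟩
  have hg : Set.InjOn (fun c => (f c : ℤ)) (↑(univ.biUnion L) : Set α) :=
    fun c hc c' hc' h => hf hc hc' (by simpa using h)
  set p := vandermondeProduct incidence (MvPolynomial.X : Fin 30 → MvPolynomial (Fin 30) ℤ)
    with hp
  set t : Fin 30 →₀ ℕ := Finsupp.equivFunOnFinite.symm fun _ => 4 with ht
  have hdeg : t.degree = 120 := by simp [ht, Finsupp.degree_eq_sum]
  have htotal : p.totalDegree = t.degree := by
    refine le_antisymm (hdeg ▸ totalDegree_vandermondeProduct_X incidence) ?_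
    exact MvPolynomial.le_totalDegree
      (MvPolynomial.mem_support_iff.2 coeff_vandermondeProduct_ne_zero)
  obtain ⟨y, hy, hne⟩ := MvPolynomial.combinatorial_nullstellensatz_exists_eval_nonzero p t
    coeff_vandermondeProduct_ne_zero htotal (fun e => (L e).image fun c => (f c : ℤ))
    fun e => by
      rw [card_image_of_injOn (hg.mono fun c hc => hmem hc)]
      exact hL e
  choose x hx hxy using fun e => mem_image.1 (hy e)
  refine ⟨x, hx, fun v i j hij => ?_⟩
  simp only [hp, map_vandermondeProduct, MvPolynomial.eval_X] at hne
  refine vandermondeProduct_ne_zero_iff.1 hne v ?_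
  simpa only [hxy] using congrArg (fun c => (f c : ℤ)) hij

theorem edge_injective : Function.Injective edge := by decide +kernel

theorem mem_edge_iff : ∀ v e, v ∈ edge e ↔ ∃ i, incidence v i = e := by decide +kernel

theorem edge_not_isDiag : ∀ e, ¬ (edge e).IsDiag := by decide +kernel

theorem edgeSet_eq_range : icosahedron.edgeSet = Set.range edge := by
  have hrange : (Set.range edge) = {s(0, 1), s(0, 2), s(0, 3), s(0, 4), s(0, 5), s(1, 2), s(1, 5),
      s(1, 6), s(1, 7), s(2, 3), s(2, 7), s(2, 8), s(3, 4), s(3, 8), s(3, 9), s(4, 5), s(4, 9),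
      s(4, 10), s(5, 6), s(5, 10), s(6, 7), s(6, 10), s(6, 11), s(7, 8), s(7, 11), s(8, 9),
      s(8, 11), s(9, 10), s(9, 11), s(10, 11)} := by
    simp only [edge, Matrix.range_cons, Matrix.range_empty, Set.union_empty, Set.singleton_union]
  rw [icosahedron, SimpleGraph.edgeSet_fromEdgeSet, ← hrange]
  refine sdiff_eq_left.2 (Set.disjoint_left.2 ?_)
  rintro _ ⟨e, rfl⟩ h
  exact edge_not_isDiag e (by simpa using h)

end Icosahedron

open Icosahedron

theorem icosahedron_listEdgeColorable : ListEdgeColorable icosahedron 5 := by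
  intro α L hL
  rw [edgeSet_eq_range] at hL ⊢
  obtain ⟨x, hxL, hx⟩ := exists_injective_choice (fun e => L (edge e)) fun e => hL _ ⟨e, rfl⟩
  refine ⟨Function.extend edge x fun _ => x 0, ?_, ?_⟩
  · rintro _ ⟨e, rfl⟩
    rw [edge_injective.extend_apply]
    exact hxL e
  · rintro _ ⟨a, rfl⟩ _ ⟨b, rfl⟩ hab ⟨v, ha, hb⟩
    rw [edge_injective.extend_apply, edge_injective.extend_apply]
    obtain ⟨i, rfl⟩ := (mem_edge_iff v a).1 ha
    obtain ⟨j, rfl⟩ := (mem_edge_iff v b).1 hb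
    exact fun h => hab (by rw [hx v h])
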